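/- Let M ≥ 1 and let ρ be a density operator on H_{N+M} (positive semidefinite with trace 1) such that p := tr(Π_phys^{(N+M)} ρ) > 0. Define the conditional state ρ^{(N)} := Trel_M(ρ) / p, where Trel_M(ρ) := Tr_M[(Π_phys^{(N)} ⊗ Π_phys^{(M)}) ρ (Π_phys^{(N)} ⊗ Π_phys^{(M)})]. Then: (a) 0 ≤ tr(ρ^{(N)}) ≤ 1 (indeed tr(Trel_M(ρ)) = tr((Π_phys^{(N)} ⊗ Π_phys^{(M)}) ρ) ≤ tr(Π_phys^{(N+M)} ρ)); (b) for every operator E on H_N with 0 ≤ E ≤ Π_phys^{(N)}, tr(E ρ^{(N)}) = tr((E ⊗ Π_phys^{(M)}) · Π_phys^{(N+M)} ρ Π_phys^{(N+M)}) / p, i.e. the conditional probability of the relational event E given the projective outcome Π_phys^{(N+M)}. -/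

import Mathlib

noncomputable section

open Matrix

namespace QRF

section Defs

variable (G : Type) [Fintype G] [DecidableEq G] [CommGroup G]

/-- The `K`-particle Hilbert space `ℂ^{G^K}` (as functions `G^K → ℂ`). -/
abbrev Vec (K : ℕ) : Type := (Fin K → G) → ℂ

/-- Linear operators on the `K`-particle Hilbert space. -/
abbrev Op (K : ℕ) : Type := Matrix (Fin K → G) (Fin K → G) ℂ

variable {G}

/-- The standard basis vector `|x⟩`. -/
def ket {K : ℕ} (x : Fin K → G) : Vec G K := fun y => if y = x then 1 else 0

/-- The global translation `T_g`, `T_g |x₁,…,x_K⟩ = |g x₁, …, g x_K⟩`. -/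
def trans {K : ℕ} (g : G) : Op G K :=
  Matrix.of fun x y => if x = (fun i => g * y i) then 1 else 0

/-- The configuration `(g, h₁ g, …, h_k g)`, i.e. `|g, hg⟩`. -/
def cfg {k : ℕ} (h : Fin k → G) (g : G) : Fin (k + 1) → G :=
  Fin.cons g fun i => h i * g

/-- The inner product `⟨v, w⟩` (antilinear in the first argument). -/
def inn {K : ℕ} (v w : Vec G K) : ℂ := star v ⬝ᵥ w

/-- The rank-one operator `|v⟩⟨w|`. -/
def outer {K : ℕ} (v w : Vec G K) : Op G K :=
  Matrix.of fun x y => v x * (starRingEnd ℂ) (w y)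

/-- The matrix element `⟨v|A|w⟩`. -/
def melem {K : ℕ} (v : Vec G K) (A : Op G K) (w : Vec G K) : ℂ :=
  star v ⬝ᵥ A.mulVec w

/-- The Hilbert–Schmidt inner product `⟨A,B⟩ := tr(A† B)`. -/
def hsInner {K : ℕ} (A B : Op G K) : ℂ := (Aᴴ * B).trace

variable (G)

/-- The symmetry group `U_sym` of relation-conditional global translations
(for `k+1` particles). -/
def Usym (k : ℕ) : Set (Op G (k + 1)) :=
  {U | U ∈ Matrix.unitaryGroup (Fin (k + 1) → G) ℂ ∧
    ∃ c : (Fin k → G) → G, ∀ (h : Fin k → G) (g : G),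
      U.mulVec (ket (cfg h g)) = (trans (c h)).mulVec (ket (cfg h g))}

/-- The characters of `G`: monoid homomorphisms `G → ℂ` of modulus one. -/
def Ghat : Type := {χ : G →* ℂ // ∀ g : G, ‖χ g‖ = 1}

/-- The trivial character `𝟙`. -/
instance : One (Ghat G) := ⟨⟨1, fun g => by simp⟩⟩

variable {G}

/-- The vector `|h;χ⟩ := |G|^{-1/2} ∑_{g ∈ G} χ(g⁻¹) |g, hg⟩`. -/
def relKet {k : ℕ} (h : Fin k → G) (χ : Ghat G) : Vec G (k + 1) :=
  ((Real.sqrt (Fintype.card G) : ℂ))⁻¹ • ∑ g : G, χ.1 g⁻¹ • ket (cfg h g)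

variable (G)

/-- The relational subspace `H_phys = span{|h;𝟙⟩}`. -/
def Hphys (k : ℕ) : Submodule ℂ (Vec G (k + 1)) :=
  Submodule.span ℂ {v | ∃ h : Fin k → G, v = relKet h (1 : Ghat G)}

/-- `Π_phys = ∑_h |h;𝟙⟩⟨h;𝟙|`, the orthogonal projection onto `H_phys`. -/
def Piphys (k : ℕ) : Op G (k + 1) :=
  ∑ h : Fin k → G, outer (relKet h (1 : Ghat G)) (relKet h (1 : Ghat G))

variable {G}

/-- `Π_{h;χ≠𝟙} = ∑_{χ ∈ Ĝ, χ ≠ 𝟙} |h;χ⟩⟨h;χ|`. -/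
def PiNot1 {k : ℕ} (h : Fin k → G) : Op G (k + 1) :=
  ∑ᶠ (χ : Ghat G) (_ : χ ≠ 1), outer (relKet h χ) (relKet h χ)

variable (G)

/-- The invariant algebra `A_inv`. -/
def Ainv (k : ℕ) : Set (Op G (k + 1)) :=
  {A | ∀ U ∈ Usym G k, U * A * Uᴴ = A}

/-- The incoherent group average (twirl) `Π_inv` over `U_sym`. -/
def Piinv (k : ℕ) (ρ : Op G (k + 1)) : Op G (k + 1) :=
  (Nat.card ↥(Usym G k) : ℂ)⁻¹ • ∑ᶠ U ∈ Usym G k, U * ρ * Uᴴ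

/-- The algebra `A_phys` of relational observables (operators supported on `H_phys`). -/
def Aphys (k : ℕ) : Set (Op G (k + 1)) :=
  {A | A = Piphys G k * A * Piphys G k}

/-- The algebra `A_alg`. -/
def Aalg (k : ℕ) : Set (Op G (k + 1)) :=
  {X | ∃ B ∈ Aphys G k, ∃ a : (Fin k → G) → ℂ,
      X = B + ∑ h : Fin k → G, a h • PiNot1 h}

variable {G}

/-- The vector `|e⟩_i ⊗ φ`. -/
def insVec {k : ℕ} (i : Fin (k + 1)) (φ : (Fin k → G) → ℂ) : Vec G (k + 1) :=
  fun x => if x i = 1 then φ (fun j => x (i.succAbove j)) else 0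

/-- The operator `|e⟩⟨e|_i ⊗ A`. -/
def eAop {k : ℕ} (i : Fin (k + 1)) (A : Matrix (Fin k → G) (Fin k → G) ℂ) :
    Op G (k + 1) :=
  Matrix.of fun x y =>
    if x i = 1 ∧ y i = 1 then
      A (fun j => x (i.succAbove j)) (fun j => y (i.succAbove j))
    else 0

/-- `ψ` is `i`-alignable. -/
def IAlignable {k : ℕ} (i : Fin (k + 1)) (ψ : Vec G (k + 1)) : Prop :=
  ∃ (θ : ℝ) (U : Op G (k + 1)) (φ : (Fin k → G) → ℂ),
    U ∈ Usym G k ∧ ψ = Complex.exp (θ * Complex.I) • U.mulVec (insVec i φ)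

/-- `ψ` is alignable. -/
def Alignable {k : ℕ} (ψ : Vec G (k + 1)) : Prop := ∃ i, IAlignable i ψ

/-- Symmetry equivalence of state vectors (up to a global phase). -/
def SymmEquiv {k : ℕ} (ψ ψ' : Vec G (k + 1)) : Prop :=
  ∃ (θ : ℝ) (U : Op G (k + 1)),
    U ∈ Usym G k ∧ ψ' = Complex.exp (θ * Complex.I) • U.mulVec ψ

/-- `P` is the orthogonal projection of operator space onto the set `S`,
with respect to the Hilbert–Schmidt inner product. -/
def IsHSProj {K : ℕ} (S : Set (Op G K)) (P : Op G K →ₗ[ℂ] Op G K) : Prop :=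
  (∀ ρ, P ρ ∈ S) ∧ (∀ A ∈ S, P A = A) ∧
    ∀ ρ σ, hsInner (P ρ) σ = hsInner ρ (P σ)

/-- First `n+1` components of an `(n+1)+(m+1)`-particle configuration. -/
def split1 {n m : ℕ} (x : Fin (n + m + 1 + 1) → G) : Fin (n + 1) → G :=
  fun i => x ⟨i.1, by have := i.2; omega⟩

/-- Last `m+1` components of an `(n+1)+(m+1)`-particle configuration. -/
def split2 {n m : ℕ} (x : Fin (n + m + 1 + 1) → G) : Fin (m + 1) → G :=
  fun i => x ⟨n + 1 + i.1, by have := i.2; omega⟩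

/-- The tensor product `A ⊗ B` of operators, under the identification
`H_{N+M} ≅ H_N ⊗ H_M`, `|x,y⟩ ↦ |x⟩ ⊗ |y⟩`. -/
def tensorOp {n m : ℕ} (A : Op G (n + 1)) (B : Op G (m + 1)) :
    Op G (n + m + 1 + 1) :=
  Matrix.of fun x y => A (split1 x) (split1 y) * B (split2 x) (split2 y)

/-- Concatenation `(h, g⃗)` of relation tuples. -/
def relcat {n m : ℕ} (h : Fin n → G) (gv : Fin (m + 1) → G) :
    Fin (n + m + 1) → G :=
  (Fin.append h gv : Fin (n + (m + 1)) → G)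

/-- Joining of configurations `(x, z)`. -/
def join {n m : ℕ} (x : Fin (n + 1) → G) (z : Fin (m + 1) → G) :
    Fin (n + m + 1 + 1) → G :=
  fun i => if hi : i.1 < n + 1 then x ⟨i.1, hi⟩
           else z ⟨i.1 - (n + 1), by have := i.2; omega⟩

/-- The standard partial trace over the last `m+1` particles. -/
def ptraceM {n m : ℕ} (ρ : Op G (n + m + 1 + 1)) : Op G (n + 1) :=
  Matrix.of fun x y => ∑ z : Fin (m + 1) → G, ρ (join x z) (join y z)

end Defs

section Configurations

variable {G : Type}

/-- The relations `x_{i+1} x_0⁻¹` of a configuration to its first particle. -/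
def relOf [CommGroup G] {k : ℕ} (x : Fin (k + 1) → G) : Fin k → G := fun i => x i.succ * (x 0)⁻¹

lemma eq_cfg_iff [CommGroup G] {k : ℕ} (x : Fin (k + 1) → G) (h : Fin k → G) (g : G) :
    x = cfg h g ↔ g = x 0 ∧ h = relOf x := by
  constructor
  · rintro rfl
    refine ⟨rfl, funext fun i => ?_⟩
    simp [relOf, cfg]
  · rintro ⟨rfl, rfl⟩
    funext i
    refine Fin.cases rfl (fun j => ?_) i
    simp [relOf, cfg]

lemma eq_translate_iff [CommGroup G] {k : ℕ} (x y : Fin (k + 1) → G) (g : G) :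
    x = (fun i => g * y i) ↔ g = x 0 * (y 0)⁻¹ ∧ relOf x = relOf y := by
  constructor
  · rintro rfl
    refine ⟨by simp, funext fun i => ?_⟩
    simp only [relOf, mul_inv]
    rw [mul_mul_mul_comm, mul_inv_cancel, one_mul]
  · rintro ⟨rfl, h⟩
    funext i
    refine Fin.cases (by simp) (fun j => ?_) i
    have hj : x j.succ * (x 0)⁻¹ = y j.succ * (y 0)⁻¹ := congrFun h j
    rw [mul_assoc, mul_comm (y 0)⁻¹, ← hj, mul_comm (x j.succ), mul_inv_cancel_left]

/-- Splitting a configuration into its first `n+1` and last `m+1` components. -/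
def splitEquiv (G : Type) (n m : ℕ) :
    (Fin (n + m + 1 + 1) → G) ≃ (Fin (n + 1) → G) × (Fin (m + 1) → G) where
  toFun x := (split1 x, split2 x)
  invFun p := join p.1 p.2
  left_inv x := by
    funext i
    by_cases hi : i.1 < n + 1
    · simp [join, split1, hi]
    · have h : n + 1 + (i.1 - (n + 1)) = i.1 := by omega
      simp [join, split2, hi, h]
  right_inv p := by
    ext i
    · simp [join, split1, i.2]
    · have h : ¬ n + 1 + i.1 < n + 1 := by omega
      simp only [join, split2, dif_neg h, Nat.add_sub_cancel_left]

open scoped Kronecker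

lemma tensorOp_eq_submatrix {n m : ℕ} (A : Op G (n + 1)) (B : Op G (m + 1)) :
    tensorOp A B = (A ⊗ₖ B).submatrix (splitEquiv G n m) (splitEquiv G n m) := rfl

lemma tensorOp_mul [Fintype G] {n m : ℕ} (A A' : Op G (n + 1)) (B B' : Op G (m + 1)) :
    tensorOp A B * tensorOp A' B' = tensorOp (A * A') (B * B') := by
  simp only [tensorOp_eq_submatrix, Matrix.submatrix_mul_equiv, Matrix.mul_kronecker_mul]

lemma tensorOp_conjTranspose {n m : ℕ} (A : Op G (n + 1)) (B : Op G (m + 1)) :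
    (tensorOp A B)ᴴ = tensorOp Aᴴ Bᴴ := by
  ext x y
  simp [tensorOp, Matrix.conjTranspose_apply]

lemma tensorOp_trans [DecidableEq G] [CommGroup G] {n m : ℕ} (g : G) :
    tensorOp (trans g : Op G (n + 1)) (trans g : Op G (m + 1)) = trans g := by
  ext x y
  have h : x = (fun i => g * y i) ↔
      split1 x = (fun i => g * split1 (n := n) (m := m) y i) ∧
        split2 x = (fun i => g * split2 (n := n) (m := m) y i) := by
    rw [← (splitEquiv G n m).injective.eq_iff]
    exact Prod.ext_iff
  simp only [tensorOp, trans, Matrix.of_apply, h, ite_and]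
  split_ifs <;> simp

lemma trace_mul_ptraceM [Fintype G] [DecidableEq G] {n m : ℕ} (E : Op G (n + 1))
    (X : Op G (n + m + 1 + 1)) :
    (E * ptraceM X).trace = (tensorOp E 1 * X).trace := by
  have hs : ∀ p : (Fin (n + 1) → G) × (Fin (m + 1) → G),
      split1 ((splitEquiv G n m).symm p) = p.1 ∧ split2 ((splitEquiv G n m).symm p) = p.2 :=
    fun p => Prod.ext_iff.1 ((splitEquiv G n m).apply_symm_apply p)
  have hj : ∀ p : (Fin (n + 1) → G) × (Fin (m + 1) → G),
      (splitEquiv G n m).symm p = join p.1 p.2 := fun _ => rfl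
  simp only [Matrix.trace, Matrix.diag_apply, Matrix.mul_apply, ptraceM, Matrix.of_apply]
  rw [← (splitEquiv G n m).symm.sum_comp, Fintype.sum_prod_type]
  refine Finset.sum_congr rfl fun x _ => ?_
  have hr : ∀ z : Fin (m + 1) → G,
      ∑ w, tensorOp E 1 ((splitEquiv G n m).symm (x, z)) w *
          X w ((splitEquiv G n m).symm (x, z)) =
        ∑ y, E x y * X (join y z) (join x z) := by
    intro z
    rw [← (splitEquiv G n m).symm.sum_comp, Fintype.sum_prod_type]
    refine Finset.sum_congr rfl fun y _ => ?_
    simp only [tensorOp, Matrix.of_apply, hs, Matrix.one_apply]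
    simp [hj]
  simp only [hr, Finset.mul_sum]
  exact Finset.sum_comm

lemma trace_ptraceM [Fintype G] [DecidableEq G] {n m : ℕ} (X : Op G (n + m + 1 + 1)) :
    (ptraceM X).trace = X.trace := by
  have h1 : tensorOp (1 : Op G (n + 1)) (1 : Op G (m + 1)) = 1 := by
    rw [tensorOp_eq_submatrix, Matrix.one_kronecker_one, Matrix.submatrix_one_equiv]
  simpa [h1] using trace_mul_ptraceM (1 : Op G (n + 1)) X

end Configurations

section RelationalProjection

variable {G : Type} [Fintype G] [DecidableEq G] [CommGroup G]

lemma relKet_one_apply {k : ℕ} (h : Fin k → G) (x : Fin (k + 1) → G) :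
    relKet h (1 : Ghat G) x =
      ((Real.sqrt (Fintype.card G) : ℂ))⁻¹ * if h = relOf x then 1 else 0 := by
  have hone : ∀ g : G, (1 : Ghat G).1 g = 1 := fun _ => rfl
  simp only [relKet, Pi.smul_apply, Finset.sum_apply, smul_eq_mul, hone, one_mul, ket,
    eq_cfg_iff]
  congr 1
  by_cases hh : h = relOf x <;> simp [hh]

lemma Piphys_apply {k : ℕ} (x y : Fin (k + 1) → G) :
    Piphys G k x y = (Fintype.card G : ℂ)⁻¹ * if relOf x = relOf y then 1 else 0 := by
  have hc : ((Real.sqrt (Fintype.card G) : ℂ))⁻¹ * ((Real.sqrt (Fintype.card G) : ℂ))⁻¹ =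
      (Fintype.card G : ℂ)⁻¹ := by
    rw [← mul_inv, ← Complex.ofReal_mul, Real.mul_self_sqrt (Nat.cast_nonneg _)]
    simp
  simp only [Piphys, Matrix.sum_apply, outer, Matrix.of_apply, relKet_one_apply, map_mul,
    map_inv₀, Complex.conj_ofReal]
  rw [← hc, Finset.sum_eq_single (relOf x)]
  · by_cases hh : relOf x = relOf y <;> simp [hh]
  · intro h _ hne
    simp [hne]
  · simp

/-- The relational projection is the average of the global translations. -/
lemma Piphys_eq_average (k : ℕ) :
    Piphys G k = (Fintype.card G : ℂ)⁻¹ • ∑ g : G, trans g := by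
  ext x y
  simp only [Piphys_apply, Matrix.smul_apply, Matrix.sum_apply, trans, Matrix.of_apply,
    smul_eq_mul, eq_translate_iff]
  congr 1
  by_cases hh : relOf x = relOf y <;> simp [hh]

lemma trans_mul_apply {K : ℕ} (g : G) (A : Op G K) (x y : Fin K → G) :
    (trans g * A : Op G K) x y = A (fun i => g⁻¹ * x i) y := by
  have hx : ∀ z : Fin K → G, x = (fun i => g * z i) ↔ z = fun i => g⁻¹ * x i := by
    intro z
    constructor <;> rintro rfl <;> simp
  simp [Matrix.mul_apply, trans, hx]

lemma trans_mul_Piphys {k : ℕ} (g : G) : trans g * Piphys G k = Piphys G k := by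
  ext x y
  have hx : relOf (fun i => g⁻¹ * x i) = relOf x :=
    ((eq_translate_iff _ x g⁻¹).1 rfl).2
  rw [trans_mul_apply, Piphys_apply, Piphys_apply, hx]

lemma Piphys_conjTranspose (k : ℕ) : (Piphys G k)ᴴ = Piphys G k := by
  ext x y
  rw [Matrix.conjTranspose_apply, Piphys_apply, Piphys_apply]
  by_cases h : relOf x = relOf y
  · simp [h]
  · simp [h, Ne.symm h]

/-- The relational projection absorbs any operator fixed by all translations. -/
lemma Piphys_mul_eq_self {k : ℕ} {A : Op G (k + 1)} (hA : ∀ g : G, trans g * A = A) :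
    Piphys G k * A = A := by
  rw [Piphys_eq_average, Matrix.smul_mul, Matrix.sum_mul]
  simp only [hA, Finset.sum_const, Finset.card_univ]
  rw [← Nat.cast_smul_eq_nsmul ℂ, smul_smul, inv_mul_cancel₀ (by simp), one_smul]

lemma Piphys_mul_self (k : ℕ) : Piphys G k * Piphys G k = Piphys G k :=
  Piphys_mul_eq_self trans_mul_Piphys

/-- The joint relational projection dominates the product of the local ones. -/
lemma Piphys_mul_tensorOp (n m : ℕ) :
    Piphys G (n + m + 1) * tensorOp (Piphys G n) (Piphys G m) =
      tensorOp (Piphys G n) (Piphys G m) :=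
  Piphys_mul_eq_self fun g => by
    rw [← tensorOp_trans, tensorOp_mul, trans_mul_Piphys, trans_mul_Piphys]

lemma tensorOp_Piphys_conjTranspose (n m : ℕ) :
    (tensorOp (Piphys G n) (Piphys G m))ᴴ = tensorOp (Piphys G n) (Piphys G m) := by
  rw [tensorOp_conjTranspose, Piphys_conjTranspose, Piphys_conjTranspose]

lemma tensorOp_mul_Piphys (n m : ℕ) :
    tensorOp (Piphys G n) (Piphys G m) * Piphys G (n + m + 1) =
      tensorOp (Piphys G n) (Piphys G m) := by
  have h := congrArg Matrix.conjTranspose (Piphys_mul_tensorOp (G := G) n m)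
  rwa [Matrix.conjTranspose_mul, tensorOp_Piphys_conjTranspose, Piphys_conjTranspose] at h

end RelationalProjection

open scoped ComplexOrder

section Projections

variable {ι : Type*} [Fintype ι]

lemma trace_projection_mul_nonneg {D ρ : Matrix ι ι ℂ} (hD : Dᴴ = D) (hDD : D * D = D)
    (hρ : ρ.PosSemidef) : 0 ≤ (D * ρ).trace := by
  have h := (hρ.mul_mul_conjTranspose_same D).trace_nonneg
  rwa [hD, Matrix.trace_mul_comm, ← Matrix.mul_assoc, hDD] at h

/-- A positive operator dominated by a projection is absorbed by it on the right. -/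
lemma mul_projection_eq_self [DecidableEq ι] {E P : Matrix ι ι ℂ} (hPP : P * P = P)
    (hE : E.PosSemidef) (hPE : (P - E).PosSemidef) : E * P = E := by
  have hz : E * (1 - P) = 0 := by
    refine Matrix.ext_of_mulVec_single fun i => ?_
    rw [← Matrix.mulVec_mulVec, Matrix.zero_mulVec]
    set w := (1 - P) *ᵥ Pi.single i 1
    have hPw : P *ᵥ w = 0 := by
      rw [Matrix.mulVec_mulVec, Matrix.mul_sub, hPP, Matrix.mul_one, sub_self,
        Matrix.zero_mulVec]
    have h1 := hPE.dotProduct_mulVec_nonneg w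
    rw [Matrix.sub_mulVec, hPw, zero_sub, dotProduct_neg, neg_nonneg] at h1
    exact (hE.dotProduct_mulVec_zero_iff w).1
      (le_antisymm h1 (hE.dotProduct_mulVec_nonneg w))
  rw [Matrix.mul_sub, Matrix.mul_one, sub_eq_zero] at hz
  exact hz.symm

lemma projection_mul_eq_self [DecidableEq ι] {E P : Matrix ι ι ℂ} (hP : Pᴴ = P)
    (hPP : P * P = P) (hE : E.PosSemidef) (hPE : (P - E).PosSemidef) : P * E = E := by
  have h := congrArg Matrix.conjTranspose (mul_projection_eq_self hPP hE hPE)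
  rwa [Matrix.conjTranspose_mul, hP, hE.1.eq] at h

end Projections

/-- For a density operator `ρ` on `H_{N+M}` with
`p := tr(Π_phys^{(N+M)} ρ) > 0`, the conditional state `ρ^{(N)} := Trel_M(ρ)/p`
(with `Trel_M(ρ) := Tr_M[(Π_phys^{(N)} ⊗ Π_phys^{(M)}) ρ (Π_phys^{(N)} ⊗ Π_phys^{(M)})]`)
is subnormalized, `tr(Trel_M ρ) = tr((Π⊗Π)ρ) ≤ tr(Π_phys^{(N+M)} ρ)`, and for every
relational event `0 ≤ E ≤ Π_phys^{(N)}` it returns the conditional probability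
`tr(E ρ^{(N)}) = tr((E ⊗ Π_phys^{(M)}) Π_phys^{(N+M)} ρ Π_phys^{(N+M)})/p`. -/
theorem stmt19 (G : Type) [Fintype G] [DecidableEq G] [CommGroup G] (n m : ℕ)
    (ρ : Op G (n + m + 1 + 1)) (hpsd : ρ.PosSemidef) (htr : ρ.trace = 1)
    (hp : 0 < ((Piphys G (n + m + 1) * ρ).trace).re) :
    ∀ (p : ℂ) (TrelRho ρN : Op G (n + 1)),
      p = (Piphys G (n + m + 1) * ρ).trace →
      TrelRho = ptraceM (tensorOp (Piphys G n) (Piphys G m) * ρ *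
        tensorOp (Piphys G n) (Piphys G m)) →
      ρN = p⁻¹ • TrelRho →
      (TrelRho.trace = (tensorOp (Piphys G n) (Piphys G m) * ρ).trace ∧
       ((tensorOp (Piphys G n) (Piphys G m) * ρ).trace).re ≤ p.re ∧
       (ρN.trace).im = 0 ∧ 0 ≤ (ρN.trace).re ∧ (ρN.trace).re ≤ 1 ∧
       ∀ E : Op G (n + 1), E.PosSemidef → (Piphys G n - E).PosSemidef →
         (E * ρN).trace =
           (tensorOp E (Piphys G m) *
             (Piphys G (n + m + 1) * ρ * Piphys G (n + m + 1))).trace / p) := by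
  rintro p TrelRho ρN rfl rfl rfl
  set P' := Piphys G (n + m + 1)
  set Q := tensorOp (Piphys G n) (Piphys G m) with hQ
  have hQQ : Q * Q = Q := by rw [hQ, tensorOp_mul, Piphys_mul_self, Piphys_mul_self]
  have hPQ : P' * Q = Q := Piphys_mul_tensorOp n m
  have hQP : Q * P' = Q := tensorOp_mul_Piphys n m
  have hQh : Qᴴ = Q := tensorOp_Piphys_conjTranspose n m
  have hPh : P'ᴴ = P' := Piphys_conjTranspose _
  have hPP : P' * P' = P' := Piphys_mul_self _
  have htrace : (ptraceM (Q * ρ * Q)).trace = (Q * ρ).trace := by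
    rw [trace_ptraceM, Matrix.trace_mul_comm, ← Matrix.mul_assoc, hQQ]
  have hQ0 : 0 ≤ (Q * ρ).trace := trace_projection_mul_nonneg hQh hQQ hpsd
  have hP0 : 0 ≤ (P' * ρ).trace := trace_projection_mul_nonneg hPh hPP hpsd
  have hle : (Q * ρ).trace ≤ (P' * ρ).trace := by
    have h := trace_projection_mul_nonneg (D := P' - Q)
      (by rw [Matrix.conjTranspose_sub, hPh, hQh])
      (by simp only [Matrix.mul_sub, Matrix.sub_mul, hPP, hPQ, hQP, hQQ]; abel) hpsd
    rwa [Matrix.sub_mul, Matrix.trace_sub, sub_nonneg] at h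
  have hre : ((Q * ρ).trace).re ≤ ((P' * ρ).trace).re := (Complex.le_def.1 hle).1
  have hQre : (((Q * ρ).trace).re : ℂ) = (Q * ρ).trace :=
    Complex.ext rfl (Complex.le_def.1 hQ0).2
  have hPre : (((P' * ρ).trace).re : ℂ) = (P' * ρ).trace :=
    Complex.ext rfl (Complex.le_def.1 hP0).2
  have hratio : ((P' * ρ).trace⁻¹ • ptraceM (Q * ρ * Q)).trace =
      ((((P' * ρ).trace).re⁻¹ * ((Q * ρ).trace).re : ℝ) : ℂ) := by
    rw [Matrix.trace_smul, htrace, smul_eq_mul, Complex.ofReal_mul, Complex.ofReal_inv, hPre,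
      hQre]
  refine ⟨htrace, hre, ?_, ?_, ?_, fun E hE hPE => ?_⟩
  · rw [hratio, Complex.ofReal_im]
  · rw [hratio, Complex.ofReal_re]
    exact mul_nonneg (inv_nonneg.2 hp.le) (Complex.le_def.1 hQ0).1
  · rw [hratio, Complex.ofReal_re, inv_mul_le_one₀ hp]
    exact hre
  · have hEP : E * Piphys G n = E := mul_projection_eq_self (Piphys_mul_self n) hE hPE
    have hPE' : Piphys G n * E = E :=
      projection_mul_eq_self (Piphys_conjTranspose n) (Piphys_mul_self n) hE hPE
    have hQF : Q * tensorOp E (Piphys G m) = tensorOp E (Piphys G m) := by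
      rw [hQ, tensorOp_mul, hPE', Piphys_mul_self]
    have hFQ : tensorOp E (Piphys G m) * Q = tensorOp E (Piphys G m) := by
      rw [hQ, tensorOp_mul, hEP, Piphys_mul_self]
    have hPF : P' * tensorOp E (Piphys G m) = tensorOp E (Piphys G m) := by
      rw [← hQF, ← Matrix.mul_assoc, hPQ]
    have hFP : tensorOp E (Piphys G m) * P' = tensorOp E (Piphys G m) := by
      rw [← hFQ, Matrix.mul_assoc, hQP]
    have hE1 : tensorOp E 1 * Q = tensorOp E (Piphys G m) := by
      rw [hQ, tensorOp_mul, hEP, Matrix.one_mul]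
    have hl : (E * ptraceM (Q * ρ * Q)).trace = (tensorOp E (Piphys G m) * ρ).trace := by
      rw [trace_mul_ptraceM, ← Matrix.mul_assoc, ← Matrix.mul_assoc, hE1,
        Matrix.trace_mul_comm, ← Matrix.mul_assoc, hQF]
    have hr : (tensorOp E (Piphys G m) * (P' * ρ * P')).trace =
        (tensorOp E (Piphys G m) * ρ).trace := by
      rw [← Matrix.mul_assoc, ← Matrix.mul_assoc, hFP, Matrix.trace_mul_comm,
        ← Matrix.mul_assoc, hPF]
    rw [Matrix.mul_smul, Matrix.trace_smul, hl, hr, smul_eq_mul, div_eq_inv_mul]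

end QRF

end
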